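/- arXiv:2307.12968 — 3 statements merged into one kernel-verified Lean document; each statement's English description precedes it below -/
import Mathlib

section
/- Let π and β be policies with π s a > 0 and β s a > 0 for all s, a, let λ ∈ [0,1], let μ s a = (1-λ) · π s a + λ · β s a, and define (U_λ Q)(s,a) = ( r s a + γ · ∑_{s'} P s a s' · ∑_{a'} μ s' a' · Q(s',a') ) · (β s a / μ s a). Fix any Q₀ : S × A → ℝ and define Q_{t+1} = U_λ Q_t. Then for all s, a, Q_t(s,a) converges as t → ∞ to Q^β(s,a) · β s a / μ s a, and this is the unique fixed point of U_λ; here Q^β is the unique fixed point of the Bellman evaluation operator T_β. -/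
open Finset Filter Topology

/-- A weighted average of reals bounded by `C` in absolute value is bounded by `C`. -/
theorem abs_sum_mul_le_of_sum_eq_one {ι : Type*} [Fintype ι] {w x : ι → ℝ} {C : ℝ}
    (hw0 : ∀ i, 0 ≤ w i) (hw1 : ∑ i, w i = 1) (hx : ∀ i, |x i| ≤ C) :
    |∑ i, w i * x i| ≤ C :=
  calc |∑ i, w i * x i| ≤ ∑ i, |w i * x i| := abs_sum_le_sum_abs _ _
    _ ≤ ∑ i, w i * C := by
      gcongr with i
      rw [abs_mul, abs_of_nonneg (hw0 i)]
      exact mul_le_mul_of_nonneg_left (hx i) (hw0 i)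
    _ = C := by rw [← sum_mul, hw1, one_mul]

/-- Iterates of the Bellman evaluation operator converge pointwise to its fixed point. -/
theorem tendsto_bellman_iterates {S A : Type*} [Fintype S] [Fintype A]
    {P : S → A → S → ℝ} (hP0 : ∀ s a s', 0 ≤ P s a s') (hP1 : ∀ s a, ∑ s', P s a s' = 1)
    {β : S → A → ℝ} (hβ0 : ∀ s a, 0 ≤ β s a) (hβ1 : ∀ s, ∑ a, β s a = 1)
    {r : S → A → ℝ} {γ : ℝ} (hγ0 : 0 ≤ γ) (hγ1 : γ < 1) {Q : S × A → ℝ}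
    (hQ : ∀ s a, Q (s, a) = r s a + γ * ∑ s', P s a s' * ∑ a', β s' a' * Q (s', a'))
    {F : ℕ → S × A → ℝ}
    (hF : ∀ t s a, F (t + 1) (s, a) =
      r s a + γ * ∑ s', P s a s' * ∑ a', β s' a' * F t (s', a')) (s : S) (a : A) :
    Tendsto (fun t => F t (s, a)) atTop (𝓝 (Q (s, a))) := by
  have bound : ∀ t s a, |F t (s, a) - Q (s, a)| ≤ γ ^ t * ‖F 0 - Q‖ := by
    intro t
    induction t with
    | zero =>
      intro s a
      simpa using norm_le_pi_norm (F 0 - Q) (s, a)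
    | succ t ih =>
      intro s a
      have h : F (t + 1) (s, a) - Q (s, a) =
          γ * ∑ s', P s a s' * ∑ a', β s' a' * (F t (s', a') - Q (s', a')) := by
        rw [hF, hQ]
        simp only [mul_sub, sum_sub_distrib]
        ring
      rw [h, abs_mul, abs_of_nonneg hγ0, pow_succ', mul_assoc]
      exact mul_le_mul_of_nonneg_left
        (abs_sum_mul_le_of_sum_eq_one (hP0 s a) (hP1 s a) fun s' =>
          abs_sum_mul_le_of_sum_eq_one (hβ0 s') (hβ1 s') (ih s')) hγ0
  rw [tendsto_iff_norm_sub_tendsto_zero]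
  refine squeeze_zero (fun _ => norm_nonneg _) (fun t => bound t s a) ?_
  simpa using (tendsto_pow_atTop_nhds_zero_of_lt_one hγ0 hγ1).mul_const ‖F 0 - Q‖

/-- The iterates of the λ-weighted regularized critic operator `U_λ` converge
pointwise to `Q^β(s,a) · β(a|s) / μ(a|s)`, which is its unique fixed point. -/
theorem lambda_regularized_critic_convergence_and_uniqueness
    {S A : Type*} [Fintype S] [Fintype A] [Nonempty S] [Nonempty A]
    (P : S → A → S → ℝ) (hP0 : ∀ s a s', 0 ≤ P s a s')
    (hP1 : ∀ s a, ∑ s', P s a s' = 1)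
    (π : S → A → ℝ) (hπ0 : ∀ s a, 0 < π s a) (hπ1 : ∀ s, ∑ a, π s a = 1)
    (β : S → A → ℝ) (hβ0 : ∀ s a, 0 < β s a) (hβ1 : ∀ s, ∑ a, β s a = 1)
    (r : S → A → ℝ) (γ : ℝ) (hγ0 : 0 ≤ γ) (hγ1 : γ < 1)
    (lam : ℝ) (hlam : lam ∈ Set.Icc (0 : ℝ) 1)
    (μ : S → A → ℝ) (hμ : ∀ s a, μ s a = (1 - lam) * π s a + lam * β s a)
    (Qβ : S × A → ℝ)
    (hQβ : ∀ s a,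
      Qβ (s, a) = r s a + γ * ∑ s', P s a s' * ∑ a', β s' a' * Qβ (s', a'))
    (Q₀ : S × A → ℝ) (Qseq : ℕ → S × A → ℝ) (hQ0 : Qseq 0 = Q₀)
    (hstep : ∀ t s a, Qseq (t + 1) (s, a) =
      (r s a + γ * ∑ s', P s a s' * ∑ a', μ s' a' * Qseq t (s', a')) * (β s a / μ s a)) :
    (∀ s a, Tendsto (fun t => Qseq t (s, a)) atTop (𝓝 (Qβ (s, a) * β s a / μ s a))) ∧
    (∀ Q : S × A → ℝ,
      (∀ s a, Q (s, a) =
        (r s a + γ * ∑ s', P s a s' * ∑ a', μ s' a' * Q (s', a')) * (β s a / μ s a)) ↔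
      Q = fun sa => Qβ sa * β sa.1 sa.2 / μ sa.1 sa.2) := by
  have hμ0 : ∀ s a, μ s a ≠ 0 := by
    intro s a
    rw [hμ]
    rcases hlam.2.eq_or_lt with h | h
    · simp [h, (hβ0 s a).ne']
    · exact (add_pos_of_pos_of_nonneg (mul_pos (sub_pos.2 h) (hπ0 s a))
        (mul_nonneg hlam.1 (hβ0 s a).le)).ne'
  have hβ' : ∀ s a, β s a ≠ 0 := fun s a => (hβ0 s a).ne'
  have conv : ∀ F : ℕ → S × A → ℝ,
      (∀ t s a, F (t + 1) (s, a) =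
        (r s a + γ * ∑ s', P s a s' * ∑ a', μ s' a' * F t (s', a')) * (β s a / μ s a)) →
      ∀ s a, Tendsto (fun t => F t (s, a)) atTop (𝓝 (Qβ (s, a) * β s a / μ s a)) := by
    intro F hF s a
    have rescale : ∀ t s a, β s a * (F t (s, a) * (μ s a / β s a)) = μ s a * F t (s, a) := by
      intro t s a
      have := hβ' s a
      field_simp
    have h := (tendsto_bellman_iterates hP0 hP1 (fun s a => (hβ0 s a).le) hβ1 hγ0 hγ1 hQβ
      (F := fun t x => F t x * (μ x.1 x.2 / β x.1 x.2)) (fun t s a => by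
        simp only [rescale, hF t s a]
        rw [mul_assoc, div_mul_div_cancel₀ (hμ0 s a), div_self (hβ' s a), mul_one])
      s a).mul_const (β s a / μ s a)
    rw [mul_div_assoc]
    refine h.congr fun t => ?_
    rw [mul_assoc, div_mul_div_cancel₀ (hβ' s a), div_self (hμ0 s a), mul_one]
  refine ⟨conv Qseq hstep, fun Q => ⟨fun hQ => ?_, ?_⟩⟩
  · ext ⟨s, a⟩
    exact tendsto_nhds_unique tendsto_const_nhds (conv (fun _ => Q) (fun _ => hQ) s a)
  · rintro rfl s a
    have h : ∀ s a, μ s a * (Qβ (s, a) * β s a / μ s a) = β s a * Qβ (s, a) := by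
      intro s a
      rw [mul_div_cancel₀ _ (hμ0 s a), mul_comm]
    simp only [h]
    rw [← hQβ, mul_div_assoc]
end

section
/- (Theorem 2.) Assume r s a > 0 for all s, a. Let π and β be policies with π s a > 0 and β s a > 0 for all s, a, let λ ∈ [0,1], let μ s a = (1-λ) · π s a + λ · β s a, and let Q*_λ be the unique fixed point of (U_λ Q)(s,a) = ( r s a + γ · ∑_{s'} P s a s' · ∑_{a'} μ s' a' · Q(s',a') ) · (β s a / μ s a). Then for every state s: ∑_{a} π s a · Real.log (Q*_λ(s,a)) = ∑_{a} π s a · ( Real.log (Q^β(s,a)) + Real.log (β s a) - Real.log (μ s a) ), where Q^β is the unique fixed point of the Bellman evaluation operator T_β. -/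
open Finset

/-- A function dominating its own discounted expected value under a policy is nonnegative. -/
lemma nonneg_of_discounted_expectation_le {S A : Type*} [Fintype S] [Fintype A]
    {P : S → A → S → ℝ} (hP0 : ∀ s a s', 0 ≤ P s a s') (hP1 : ∀ s a, ∑ s', P s a s' = 1)
    {ν : S → A → ℝ} (hν0 : ∀ s a, 0 ≤ ν s a) (hν1 : ∀ s, ∑ a, ν s a = 1)
    {γ : ℝ} (hγ0 : 0 ≤ γ) (hγ1 : γ < 1) {Q : S × A → ℝ}
    (hQ : ∀ s a, γ * ∑ s', P s a s' * ∑ a', ν s' a' * Q (s', a') ≤ Q (s, a))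
    (s : S) (a : A) : 0 ≤ Q (s, a) := by
  have : Nonempty (S × A) := ⟨(s, a)⟩
  obtain ⟨⟨s₀, a₀⟩, hmin⟩ := Finite.exists_min Q
  have inner (s' : S) : Q (s₀, a₀) ≤ ∑ a', ν s' a' * Q (s', a') :=
    calc Q (s₀, a₀) = ∑ a', ν s' a' * Q (s₀, a₀) := by rw [← Finset.sum_mul, hν1, one_mul]
      _ ≤ _ := Finset.sum_le_sum fun a' _ => mul_le_mul_of_nonneg_left (hmin _) (hν0 s' a')
  have outer : Q (s₀, a₀) ≤ ∑ s', P s₀ a₀ s' * ∑ a', ν s' a' * Q (s', a') :=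
    calc Q (s₀, a₀) = ∑ s', P s₀ a₀ s' * Q (s₀, a₀) := by rw [← Finset.sum_mul, hP1, one_mul]
      _ ≤ _ := Finset.sum_le_sum fun s' _ => mul_le_mul_of_nonneg_left (inner s') (hP0 s₀ a₀ s')
  have hdisc := (mul_le_mul_of_nonneg_left outer hγ0).trans (hQ s₀ a₀)
  exact le_trans (by nlinarith) (hmin (s, a))

/-- A Bellman evaluation fixed point is at most any other one. -/
lemma bellman_fixedPoint_le {S A : Type*} [Fintype S] [Fintype A]
    {P : S → A → S → ℝ} (hP0 : ∀ s a s', 0 ≤ P s a s') (hP1 : ∀ s a, ∑ s', P s a s' = 1)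
    {ν : S → A → ℝ} (hν0 : ∀ s a, 0 ≤ ν s a) (hν1 : ∀ s, ∑ a, ν s a = 1)
    {γ : ℝ} (hγ0 : 0 ≤ γ) (hγ1 : γ < 1) {r : S → A → ℝ} {Q Q' : S × A → ℝ}
    (hQ : ∀ s a, Q (s, a) = r s a + γ * ∑ s', P s a s' * ∑ a', ν s' a' * Q (s', a'))
    (hQ' : ∀ s a, Q' (s, a) = r s a + γ * ∑ s', P s a s' * ∑ a', ν s' a' * Q' (s', a'))
    (s : S) (a : A) : Q (s, a) ≤ Q' (s, a) := by
  refine sub_nonneg.mp (nonneg_of_discounted_expectation_le (Q := fun x => Q' x - Q x)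
    hP0 hP1 hν0 hν1 hγ0 hγ1 (fun s a => ?_) s a)
  simp only [mul_sub, Finset.sum_sub_distrib]
  linarith [hQ s a, hQ' s a]

/-- Theorem 2: the un-regularized actor objective evaluated with the fixed
point of the λ-weighted regularized critic operator equals the λ-weighted
one-step RL actor objective. -/
theorem lambda_one_step_rl_eq_critic_regularization
    {S A : Type*} [Fintype S] [Fintype A] [Nonempty S] [Nonempty A]
    (P : S → A → S → ℝ) (hP0 : ∀ s a s', 0 ≤ P s a s')
    (hP1 : ∀ s a, ∑ s', P s a s' = 1)
    (π : S → A → ℝ) (hπ0 : ∀ s a, 0 < π s a) (hπ1 : ∀ s, ∑ a, π s a = 1)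
    (β : S → A → ℝ) (hβ0 : ∀ s a, 0 < β s a) (hβ1 : ∀ s, ∑ a, β s a = 1)
    (r : S → A → ℝ) (hr : ∀ s a, 0 < r s a)
    (γ : ℝ) (hγ0 : 0 ≤ γ) (hγ1 : γ < 1)
    (lam : ℝ) (hlam : lam ∈ Set.Icc (0 : ℝ) 1)
    (μ : S → A → ℝ) (hμ : ∀ s a, μ s a = (1 - lam) * π s a + lam * β s a)
    (Qβ : S × A → ℝ)
    (hQβ : ∀ s a,
      Qβ (s, a) = r s a + γ * ∑ s', P s a s' * ∑ a', β s' a' * Qβ (s', a'))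
    (Qstar : S × A → ℝ)
    (hQstar : ∀ s a, Qstar (s, a) =
      (r s a + γ * ∑ s', P s a s' * ∑ a', μ s' a' * Qstar (s', a')) * (β s a / μ s a)) :
    ∀ s, ∑ a, π s a * Real.log (Qstar (s, a)) =
      ∑ a, π s a * (Real.log (Qβ (s, a)) + Real.log (β s a) - Real.log (μ s a)) := by
  have hμ0 (s : S) (a : A) : 0 < μ s a := by
    rw [hμ]
    obtain ⟨h0, h1⟩ := hlam
    rcases h0.eq_or_lt with rfl | h0
    · simpa using hπ0 s a
    · exact add_pos_of_nonneg_of_pos (mul_nonneg (sub_nonneg.mpr h1) (hπ0 s a).le)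
        (mul_pos h0 (hβ0 s a))
  have hβ0' (s : S) (a : A) : 0 ≤ β s a := (hβ0 s a).le
  have hQβ_nonneg := nonneg_of_discounted_expectation_le (Q := Qβ) hP0 hP1 hβ0' hβ1 hγ0 hγ1
    fun s a => by linarith [hQβ s a, hr s a]
  have hQβ_pos (s : S) (a : A) : 0 < Qβ (s, a) := by
    rw [hQβ]
    exact add_pos_of_pos_of_nonneg (hr s a) (mul_nonneg hγ0
      (Finset.sum_nonneg fun s' _ => mul_nonneg (hP0 s a s')
        (Finset.sum_nonneg fun a' _ => mul_nonneg (hβ0' s' a') (hQβ_nonneg s' a'))))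
  -- Reweighting `Qstar` by `μ / β` turns it into a fixed point of the evaluation operator of `β`.
  let W : S × A → ℝ := fun x => Qstar x * (μ x.1 x.2 / β x.1 x.2)
  have hβW (s : S) (a : A) : β s a * W (s, a) = μ s a * Qstar (s, a) := by
    have := (hβ0 s a).ne'
    simp only [W]
    field_simp
  have hW (s : S) (a : A) :
      W (s, a) = r s a + γ * ∑ s', P s a s' * ∑ a', β s' a' * W (s', a') := by
    have hβ := (hβ0 s a).ne'
    have hμ := (hμ0 s a).ne'
    simp only [hβW]
    change Qstar (s, a) * (μ s a / β s a) = _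
    rw [hQstar s a, mul_assoc, div_mul_div_cancel₀ hμ, div_self hβ, mul_one]
  intro s
  refine Finset.sum_congr rfl fun a _ => ?_
  have hWQ : W (s, a) = Qβ (s, a) := le_antisymm
    (bellman_fixedPoint_le hP0 hP1 hβ0' hβ1 hγ0 hγ1 hW hQβ s a)
    (bellman_fixedPoint_le hP0 hP1 hβ0' hβ1 hγ0 hγ1 hQβ hW s a)
  have hstar : Qstar (s, a) = Qβ (s, a) * β s a / μ s a := by
    rw [eq_div_iff (hμ0 s a).ne', ← hWQ]
    linarith [hβW s a]
  rw [hstar, Real.log_div (mul_pos (hQβ_pos s a) (hβ0 s a)).ne' (hμ0 s a).ne',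
    Real.log_mul (hQβ_pos s a).ne' (hβ0 s a).ne']
end

section
/- (Theorem 3, fixed-point part, goal-conditioned setting.) Let β be a policy with β s a > 0 for all s, a, and let π be a goal-conditioned policy (for each goal g ∈ S and state s, a probability distribution π g s over A) with π g s a > 0 for all g, s, a. Define the behavioral C-learning operator (T_β^C Q̃)(s,a,g) = (1-γ) · P s a g + γ · ∑_{s'} P s a s' · ∑_{a'} β s' a' · Q̃(s',a',g), and let Q̃^β be its unique fixed point. Define the regularized C-learning operator (U Q)(s,a,g) = ( (1-γ) · P s a g + γ · ∑_{s'} P s a s' · ∑_{a'} π g s' a' · Q(s',a',g) ) · (β s a / π g s a). Then for any Q₀ : S × A × S → ℝ, the iterates Q_{t+1} = U Q_t converge pointwise to Q*(s,a,g) = Q̃^β(s,a,g) · β s a / π g s a, which is the unique fixed point of U. -/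
open Finset Filter Topology

/-- An average with nonnegative weights of total mass one stays within any bound on the values. -/
theorem abs_sum_mul_le_of_weights {ι : Type*} [Fintype ι] {w f : ι → ℝ} {C : ℝ}
    (hw0 : ∀ i, 0 ≤ w i) (hw1 : ∑ i, w i = 1) (hf : ∀ i, |f i| ≤ C) :
    |∑ i, w i * f i| ≤ C :=
  calc |∑ i, w i * f i| ≤ ∑ i, |w i * f i| := abs_sum_le_sum_abs _ _
    _ ≤ ∑ i, w i * C := by
        refine sum_le_sum fun i _ => ?_
        rw [abs_mul, abs_of_nonneg (hw0 i)]
        exact mul_le_mul_of_nonneg_left (hf i) (hw0 i)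
    _ = C := by rw [← sum_mul, hw1, one_mul]

/-- Iterating a discounted policy-evaluation operator without reward drives every function to
zero. -/
theorem tendsto_zero_of_discounted_average {S A : Type*} [Fintype S] [Fintype A]
    {P : S → A → S → ℝ} (hP0 : ∀ s a s', 0 ≤ P s a s') (hP1 : ∀ s a, ∑ s', P s a s' = 1)
    {β : S → A → ℝ} (hβ0 : ∀ s a, 0 ≤ β s a) (hβ1 : ∀ s, ∑ a, β s a = 1)
    {γ : ℝ} (hγ0 : 0 ≤ γ) (hγ1 : γ < 1) {D : ℕ → S → A → ℝ}
    (hD : ∀ t s a, D (t + 1) s a = γ * ∑ s', P s a s' * ∑ a', β s' a' * D t s' a')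
    (s : S) (a : A) : Tendsto (fun t => D t s a) atTop (𝓝 0) := by
  have bound : ∀ t s a, |D t s a| ≤ γ ^ t * ∑ x : S × A, |D 0 x.1 x.2| := by
    intro t
    induction t with
    | zero =>
      intro s a
      rw [pow_zero, one_mul]
      exact single_le_sum (f := fun x : S × A => |D 0 x.1 x.2|)
        (fun _ _ => abs_nonneg _) (mem_univ (s, a))
    | succ t ih =>
      intro s a
      rw [hD, abs_mul, abs_of_nonneg hγ0, pow_succ', mul_assoc]
      exact mul_le_mul_of_nonneg_left
        (abs_sum_mul_le_of_weights (hP0 s a) (hP1 s a) fun s' =>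
          abs_sum_mul_le_of_weights (hβ0 s') (hβ1 s') (ih s')) hγ0
  refine squeeze_zero_norm (fun t => bound t s a) ?_
  simpa using (tendsto_pow_atTop_nhds_zero_of_lt_one hγ0 hγ1).mul_const
    (∑ x : S × A, |D 0 x.1 x.2|)

/-- Theorem 3 (fixed-point part, goal-conditioned C-learning): the iterates of
the regularized C-learning operator converge pointwise to
`Q̃^β(s,a,g) · β(a|s) / π(a|s,g)`, which is its unique fixed point. -/
theorem goal_conditioned_regularized_critic_convergence
    {S A : Type*} [Fintype S] [Fintype A] [Nonempty S] [Nonempty A]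
    (P : S → A → S → ℝ) (hP0 : ∀ s a s', 0 ≤ P s a s')
    (hP1 : ∀ s a, ∑ s', P s a s' = 1)
    (β : S → A → ℝ) (hβ0 : ∀ s a, 0 < β s a) (hβ1 : ∀ s, ∑ a, β s a = 1)
    (π : S → S → A → ℝ) (hπ0 : ∀ g s a, 0 < π g s a) (hπ1 : ∀ g s, ∑ a, π g s a = 1)
    (γ : ℝ) (hγ0 : 0 ≤ γ) (hγ1 : γ < 1)
    (Qβ : S × A × S → ℝ)
    (hQβ : ∀ s a g, Qβ (s, a, g) =
      (1 - γ) * P s a g + γ * ∑ s', P s a s' * ∑ a', β s' a' * Qβ (s', a', g))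
    (Q₀ : S × A × S → ℝ) (Qseq : ℕ → S × A × S → ℝ) (hQ0 : Qseq 0 = Q₀)
    (hstep : ∀ t s a g, Qseq (t + 1) (s, a, g) =
      ((1 - γ) * P s a g + γ * ∑ s', P s a s' * ∑ a', π g s' a' * Qseq t (s', a', g))
        * (β s a / π g s a)) :
    (∀ s a g, Tendsto (fun t => Qseq t (s, a, g)) atTop
      (𝓝 (Qβ (s, a, g) * β s a / π g s a))) ∧
    (∀ Q : S × A × S → ℝ,
      (∀ s a g, Q (s, a, g) =
        ((1 - γ) * P s a g + γ * ∑ s', P s a s' * ∑ a', π g s' a' * Q (s', a', g))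
          * (β s a / π g s a)) ↔
      Q = fun x => Qβ x * β x.1 x.2.1 / π x.2.2 x.1 x.2.1) := by
  have conv : ∀ R : ℕ → S × A × S → ℝ,
      (∀ t s a g, R (t + 1) (s, a, g) =
        ((1 - γ) * P s a g + γ * ∑ s', P s a s' * ∑ a', π g s' a' * R t (s', a', g))
          * (β s a / π g s a)) →
      ∀ s a g, Tendsto (fun t => R t (s, a, g)) atTop
        (𝓝 (Qβ (s, a, g) * β s a / π g s a)) := by
    intro R hR s a g
    have hD := tendsto_zero_of_discounted_average hP0 hP1 (fun s a => (hβ0 s a).le) hβ1 hγ0 hγ1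
      (D := fun t s a => R t (s, a, g) * (π g s a / β s a) - Qβ (s, a, g)) (by
        intro t s a
        have hβ := (hβ0 s a).ne'
        have hπ := (hπ0 g s a).ne'
        have inner : ∀ s', ∑ a', β s' a' * (R t (s', a', g) * (π g s' a' / β s' a')
            - Qβ (s', a', g)) =
            ∑ a', π g s' a' * R t (s', a', g) - ∑ a', β s' a' * Qβ (s', a', g) := by
          intro s'
          rw [← sum_sub_distrib]
          refine sum_congr rfl fun a' _ => ?_
          have := (hβ0 s' a').ne'
          field_simp
        have cancel : β s a / π g s a * (π g s a / β s a) = 1 := by field_simp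
        simp only [inner]
        simp only [mul_sub, sum_sub_distrib]
        rw [hR, hQβ s a g, mul_assoc, cancel]
        ring) s a
    have hβ := (hβ0 s a).ne'
    have hπ := (hπ0 g s a).ne'
    have hlim := (hD.add_const (Qβ (s, a, g))).mul_const (β s a / π g s a)
    rw [zero_add, ← mul_div_assoc] at hlim
    refine hlim.congr fun t => ?_
    field_simp
    ring
  refine ⟨conv Qseq hstep, fun Q => ⟨fun hQ => ?_, ?_⟩⟩
  · funext ⟨s, a, g⟩
    exact tendsto_nhds_unique tendsto_const_nhds (conv (fun _ => Q) (fun _ => hQ) s a g)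
  · rintro rfl s a g
    have inner : ∀ s', ∑ a', π g s' a' * (Qβ (s', a', g) * β s' a' / π g s' a') =
        ∑ a', β s' a' * Qβ (s', a', g) := by
      intro s'
      refine sum_congr rfl fun a' _ => ?_
      have := (hπ0 g s' a').ne'
      field_simp
    simp only [inner]
    rw [← hQβ s a g, mul_div_assoc]
end
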